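/- Let n = 2m with m odd, q = 2^m. In the proof setting of Lemma 3.2: let d ∈ F_{2^n}^* and A = d^{2^s - 1} where 3s ≡ 1 (mod n). If A ≠ 1 and (A+1)^{2^s+1}/A^{2^s} ∈ F_{2^m}, then A is a cube in F_{2^n}, and hence d is a cube in F_{2^n}. -/

import Mathlib

lemma three_dvd_aux (k : ℕ) (hk : Odd k) : ∃ t, 2 ^ k + 1 = 3 * t := by
  have h := hk.nat_add_dvd_pow_add_pow 2 1
  rw [one_pow] at h
  exact h

theorem stmt_9 (m s : ℕ) (hm : 0 < m) (hodd : Odd m) (hs : 0 < s)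
    (hs1 : 3 * s ≡ 1 [MOD 2 * m])
    (d : GaloisField 2 (2 * m)) (hd : d ≠ 0)
    (A : GaloisField 2 (2 * m)) (hA : A = d ^ (2 ^ s - 1)) (hA1 : A ≠ 1)
    (h : ((A + 1) ^ (2 ^ s + 1) / A ^ (2 ^ s)) ^ (2 ^ m) =
          (A + 1) ^ (2 ^ s + 1) / A ^ (2 ^ s)) :
    (∃ β : GaloisField 2 (2 * m), β ^ 3 = A) ∧
      (∃ γ : GaloisField 2 (2 * m), γ ^ 3 = d) := by
  have hsodd : Odd s := by
    have h2 : 3 * s ≡ 1 [MOD 2] := hs1.of_mul_right m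
    rw [Nat.odd_iff]
    unfold Nat.ModEq at h2
    omega
  obtain ⟨t, ht⟩ := three_dvd_aux s hsodd
  obtain ⟨k, hk⟩ := three_dvd_aux m hodd
  have hA0 : A ≠ 0 := by rw [hA]; exact pow_ne_zero _ hd
  have hB0 : A + 1 ≠ 0 := by
    intro h0
    apply hA1
    rw [eq_neg_of_add_eq_zero_left h0, CharTwo.neg_eq]
  obtain ⟨R, hR⟩ : ∃ R, R = (A + 1) ^ (2 ^ s + 1) / A ^ (2 ^ s) := ⟨_, rfl⟩
  rw [← hR] at h
  have hR0 : R ≠ 0 := by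
    rw [hR]; exact div_ne_zero (pow_ne_zero _ hB0) (pow_ne_zero _ hA0)
  -- `R` is a cube
  have hRk : (R ^ k) ^ 3 = R ^ 2 := by
    rw [← pow_mul, mul_comm k 3, ← hk, pow_succ, h, sq]
  have hRc : (R / R ^ k) ^ 3 = R := by
    rw [div_pow, hRk]; field_simp
  have hRA : R * A ^ (2 ^ s) = ((A + 1) ^ t) ^ 3 := by
    rw [← pow_mul, mul_comm t 3, ← ht, hR]
    field_simp
  have hAt : (A ^ t) ^ 3 = A ^ (2 ^ s) * A := by
    rw [← pow_mul, mul_comm t 3, ← ht, pow_succ]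
  have hdt : (d ^ t) ^ 3 = A * d ^ 2 := by
    rw [← pow_mul, mul_comm t 3, ← ht, hA, ← pow_add]
    congr 1
    have := Nat.one_le_two_pow (n := s)
    omega
  have hAc : ∃ β : GaloisField 2 (2 * m), β ^ 3 = A := by
    refine ⟨A ^ t * (R / R ^ k) / (A + 1) ^ t, ?_⟩
    rw [div_pow, mul_pow, hRc, hAt, ← hRA]
    have := pow_ne_zero (2 ^ s) hA0
    field_simp
  refine ⟨hAc, ?_⟩
  obtain ⟨β, hβ⟩ := hAc
  refine ⟨d * β / d ^ t, ?_⟩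
  rw [div_pow, mul_pow, hdt, hβ]
  field_simp
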